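/- Let X be a Hausdorff space, p₀, p₁, p* three distinct points, and f a loop at p₁ with f⁻¹({p₀}) = ∅ and f⁻¹({p*}) a singleton. If f is null-homotopic in X, then there exists a loop f' in X \ {p₀, p*} such that f and f' are homotopic (rel endpoints) in X \ {p₀}. -/

import Mathlib

section GridGraph

/-- The sum of a weight function over the steps of a walk. -/
def SimpleGraph.Walk.stepSum {V M : Type*} [AddMonoid M] {G : SimpleGraph V} (s : V → V → M) :
    ∀ {u v : V}, G.Walk u v → M
  | _, _, .nil => 0
  | u, _, .cons (v := v) _ p => s u v + p.stepSum s

theorem SimpleGraph.Walk.stepSum_append {V M : Type*} [AddMonoid M] {G : SimpleGraph V}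
    (s : V → V → M) {u v w : V} (p : G.Walk u v) (q : G.Walk v w) :
    (p.append q).stepSum s = p.stepSum s + q.stepSum s := by
  induction p with
  | nil => simp [stepSum]
  | cons h p ih => simp [stepSum, ih, add_assoc]

theorem SimpleGraph.Walk.stepSum_eq_sub {V M : Type*} [AddCommGroup M] {G : SimpleGraph V}
    {s : V → V → M} {f : V → M} (hs : ∀ u v, G.Adj u v → s u v = f v - f u) {u v : V}
    (p : G.Walk u v) : p.stepSum s = f v - f u := by
  induction p with
  | nil => simp [stepSum]
  | cons h p ih => simp [stepSum, ih, hs _ _ h]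

theorem SimpleGraph.Walk.stepSum_sub {V M : Type*} [AddCommGroup M] {G : SimpleGraph V}
    (s t : V → V → M) {u v : V} (p : G.Walk u v) :
    p.stepSum (fun a b => s a b - t a b) = p.stepSum s - p.stepSum t := by
  induction p with
  | nil => simp [stepSum]
  | cons h p ih => simp only [stepSum, ih]; abel

/-- The cell `(i, j)` of the integer grid is the unit square with lower left corner `(i, j)`.
`GridEdge S u v` says that `v` is the right or upper neighbour of `u` and that the edge from `u`
to `v` is a side of a cell in `S`. -/
def GridEdge (S : Set (ℤ × ℤ)) (u v : ℤ × ℤ) : Prop :=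
  (v = (u.1 + 1, u.2) ∧ (u ∈ S ∨ (u.1, u.2 - 1) ∈ S)) ∨
    (v = (u.1, u.2 + 1) ∧ (u ∈ S ∨ (u.1 - 1, u.2) ∈ S))

/-- The graph formed by the sides of a set of cells of the integer grid. -/
def gridGraph (S : Set (ℤ × ℤ)) : SimpleGraph (ℤ × ℤ) where
  Adj u v := GridEdge S u v ∨ GridEdge S v u
  symm := ⟨fun _ _ h => h.symm⟩
  loopless := ⟨fun u h => by
    rcases h with (⟨h, -⟩ | ⟨h, -⟩) | (⟨h, -⟩ | ⟨h, -⟩) <;> simp [Prod.ext_iff] at h⟩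

/-- The signed crossing of the step from `u` to `v` with the vertical ray going up from the
centre of the cell `c`. -/
def rayCrossing (c u v : ℤ × ℤ) : ℤ :=
  if u.2 = v.2 ∧ c.2 < u.2 then
    if u.1 = c.1 ∧ v.1 = c.1 + 1 then 1 else if u.1 = c.1 + 1 ∧ v.1 = c.1 then -1 else 0
  else 0

theorem stepSum_rayCrossing_right {S : Set (ℤ × ℤ)} {x y : ℤ} (h₁ : (x, y) ∉ S)
    (h₂ : (x + 1, y) ∉ S) {u : ℤ × ℤ} (w : (gridGraph S).Walk u u) :
    w.stepSum (rayCrossing (x, y)) = w.stepSum (rayCrossing (x + 1, y)) := by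
  have key := SimpleGraph.Walk.stepSum_eq_sub (G := gridGraph S)
    (s := fun a b => rayCrossing (x, y) a b - rayCrossing (x + 1, y) a b)
    (f := fun v => if v.1 = x + 1 ∧ y < v.2 then 1 else 0) ?_ w
  · rw [SimpleGraph.Walk.stepSum_sub] at key
    linarith
  · rintro ⟨a, b⟩ ⟨a', b'⟩ h
    rcases h with (⟨h, h'⟩ | ⟨h, h'⟩) | (⟨h, h'⟩ | ⟨h, h'⟩) <;>
      simp only [Prod.mk.injEq] at h <;> obtain ⟨rfl, rfl⟩ := h <;>
      simp only [rayCrossing] <;> grind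

theorem stepSum_rayCrossing_up {S : Set (ℤ × ℤ)} {x y : ℤ} (h₁ : (x, y) ∉ S)
    (h₂ : (x, y + 1) ∉ S) {u : ℤ × ℤ} (w : (gridGraph S).Walk u u) :
    w.stepSum (rayCrossing (x, y)) = w.stepSum (rayCrossing (x, y + 1)) := by
  have key := SimpleGraph.Walk.stepSum_eq_sub (G := gridGraph S)
    (s := fun a b => rayCrossing (x, y) a b - rayCrossing (x, y + 1) a b)
    (f := fun v => 0) ?_ w
  · rw [SimpleGraph.Walk.stepSum_sub] at key
    linarith
  · rintro ⟨a, b⟩ ⟨a', b'⟩ h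
    rcases h with (⟨h, h'⟩ | ⟨h, h'⟩) | (⟨h, h'⟩ | ⟨h, h'⟩) <;>
      simp only [Prod.mk.injEq] at h <;> obtain ⟨rfl, rfl⟩ := h <;>
      simp only [rayCrossing] <;> grind

/-- If all cells of `S` lie in the square of side `n`, a closed walk along sides of cells of `S`
does not wind around any cell outside that square. -/
theorem stepSum_rayCrossing_outside {S : Set (ℤ × ℤ)} {n : ℤ}
    (hS : ∀ c ∈ S, 0 ≤ c.1 ∧ c.1 < n ∧ 0 ≤ c.2 ∧ c.2 < n) {c : ℤ × ℤ}
    (hc : ¬(0 ≤ c.1 ∧ c.1 < n ∧ 0 ≤ c.2 ∧ c.2 < n)) {u : ℤ × ℤ} (w : (gridGraph S).Walk u u) :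
    w.stepSum (rayCrossing c) = 0 := by
  have key := SimpleGraph.Walk.stepSum_eq_sub (G := gridGraph S) (s := rayCrossing c)
    (f := fun v => if c.2 < 0 ∧ c.1 < v.1 then 1 else 0) ?_ w
  · rw [key, sub_self]
  · rintro ⟨a, b⟩ ⟨a', b'⟩ h
    rcases h with (⟨h, h' | h'⟩ | ⟨h, h' | h'⟩) | (⟨h, h' | h'⟩ | ⟨h, h' | h'⟩) <;>
      simp only [Prod.mk.injEq] at h <;> obtain ⟨rfl, rfl⟩ := h <;>
      have := hS _ h' <;>
      simp only [rayCrossing] <;> grind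

theorem stepSum_rayCrossing_of_top {S : Set (ℤ × ℤ)} {a b u : ℤ × ℤ}
    (w : (gridGraph S).Walk a b) (hu : u ∉ w.support) (hw : ∀ v ∈ w.support, v.2 ≤ u.2) :
    w.stepSum (rayCrossing (u.1 - 1, u.2 - 1)) = 0 := by
  induction w with
  | nil => rfl
  | @cons a d b h p ih =>
    simp only [SimpleGraph.Walk.support_cons, List.mem_cons, not_or, forall_eq_or_imp] at hu hw
    rw [SimpleGraph.Walk.stepSum, ih hu.2 hw.2, add_zero]
    have hd : u ≠ d := fun h => hu.2 (h ▸ p.start_mem_support)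
    have hd' := hw.2 d p.start_mem_support
    have h1 := hu.1
    have h2 := hw.1
    simp only [ne_eq, Prod.ext_iff] at hd h1
    simp only [rayCrossing]
    grind

open CategoryTheory

variable {𝒞 : Type*} [Groupoid 𝒞]

/-- The composite of the morphisms attached to the edges of a walk. -/
def SimpleGraph.Walk.comp {V : Type*} {G : SimpleGraph V} {ob : V → 𝒞}
    (hom : ∀ {u v}, G.Adj u v → (ob u ⟶ ob v)) : ∀ {u v : V}, G.Walk u v → (ob u ⟶ ob v)
  | _, _, .nil => 𝟙 _
  | _, _, .cons h p => hom h ≫ p.comp hom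

theorem SimpleGraph.Walk.comp_append {V : Type*} {G : SimpleGraph V} {ob : V → 𝒞}
    (hom : ∀ {u v}, G.Adj u v → (ob u ⟶ ob v)) {u v w : V} (p : G.Walk u v) (q : G.Walk v w) :
    (p.append q).comp hom = p.comp hom ≫ q.comp hom := by
  induction p with
  | nil => simp [SimpleGraph.Walk.comp]
  | cons h p ih => simp [SimpleGraph.Walk.comp, ih]

theorem comp_eq_id_comm {a b : 𝒞} {p : a ⟶ b} {q : b ⟶ a} (h : q ≫ p = 𝟙 b) : p ≫ q = 𝟙 a := by
  rw [← cancel_epi q, ← Category.assoc, h, Category.id_comp, Category.comp_id]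

/-- A family of morphisms attached to the sides of the cells in `S` that commutes around each of
these cells has trivial holonomy, provided that no closed walk winds around a cell not in `S`. -/
theorem comp_closed_walk_eq_id {S : Set (ℤ × ℤ)} (hS : ∀ c ∈ S, 0 ≤ c.1 ∧ 0 ≤ c.2)
    (hwind : ∀ c ∉ S, ∀ (u : ℤ × ℤ) (w : (gridGraph S).Walk u u), w.stepSum (rayCrossing c) = 0)
    {ob : ℤ × ℤ → 𝒞} (hom : ∀ {u v}, (gridGraph S).Adj u v → (ob u ⟶ ob v))
    (hinv : ∀ {u v} (h : (gridGraph S).Adj u v) (h' : (gridGraph S).Adj v u),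
      hom h ≫ hom h' = 𝟙 _)
    (hsq : ∀ c ∈ S, ∀ a b d : ℤ × ℤ, d = (c.1 + 1, c.2 + 1) →
      (a = (c.1, c.2 + 1) ∧ b = (c.1 + 1, c.2) ∨ a = (c.1 + 1, c.2) ∧ b = (c.1, c.2 + 1)) →
      ∀ (h₁ : (gridGraph S).Adj a d) (h₂ : (gridGraph S).Adj d b) (h₃ : (gridGraph S).Adj a c)
        (h₄ : (gridGraph S).Adj c b), hom h₁ ≫ hom h₂ = hom h₃ ≫ hom h₄)
    {u : ℤ × ℤ} (w : (gridGraph S).Walk u u) : w.comp hom = 𝟙 _ := by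
  set wt : ℤ × ℤ → ℤ × ℤ → ℕ := fun v _ => (v.1 + v.2).toNat + 1 with hwt
  generalize hn : w.stepSum wt = n
  induction n using Nat.strong_induction_on generalizing u with
  | _ n ih =>
  subst hn
  by_cases hnil : w.Nil
  · cases w with
    | nil => rfl
    | cons => simp at hnil
  obtain ⟨t, ht, htop⟩ := w.support.toFinset.exists_max_image (fun v => toLex (v.2, v.1))
    ⟨u, by simp⟩
  simp only [List.mem_toFinset] at ht htop
  -- Rotate the walk so that it starts at the highest, rightmost vertex `t`.
  set p := w.takeUntil t ht
  set q := w.dropUntil t ht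
  have hpq : p.append q = w := w.take_spec ht
  rw [← hpq, SimpleGraph.Walk.comp_append]
  refine comp_eq_id_comm ?_
  rw [← SimpleGraph.Walk.comp_append]
  have hsum : (q.append p).stepSum wt = w.stepSum wt := by
    rw [← hpq, SimpleGraph.Walk.stepSum_append, SimpleGraph.Walk.stepSum_append, add_comm]
  have hsupp : ∀ v ∈ (q.append p).support, toLex (v.2, v.1) ≤ toLex (t.2, t.1) := fun v hv =>
    htop v <| by
      rw [← hpq]
      simp only [SimpleGraph.Walk.mem_support_append_iff] at hv ⊢
      exact hv.symm
  have hlen : (q.append p).length ≠ 0 := by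
    have : w.length ≠ 0 := by rwa [ne_eq, SimpleGraph.Walk.length_eq_zero_iff]
    rw [← hpq] at this
    simp only [SimpleGraph.Walk.length_append] at this ⊢
    omega
  rw [← hsum] at ih
  generalize q.append p = w' at ih hsupp hlen ⊢
  clear! w
  cases w' with
  | nil => simp at hlen
  | @cons _ a _ h₁ w₁ =>
  obtain ⟨b, w₂, h₂, rfl⟩ : ∃ (b : ℤ × ℤ) (w₂ : (gridGraph S).Walk a b)
      (h₂ : (gridGraph S).Adj b t), w₁ = w₂.append (.cons h₂ .nil) := by
    cases w₁ with
    | nil => exact absurd h₁ ((gridGraph S).irrefl)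
    | cons h p =>
      obtain ⟨x, r, h', hr⟩ := SimpleGraph.Walk.exists_cons_eq_concat h p
      exact ⟨x, r, h', by rw [hr, SimpleGraph.Walk.concat_eq_append]⟩
  by_cases hmem : t ∈ w₂.support
  · -- Split at a second visit of `t`.
    have hw₂ := w₂.take_spec hmem
    set r := w₂.takeUntil t hmem
    set s := w₂.dropUntil t hmem
    have e₁ := ih _ ?_ (SimpleGraph.Walk.cons h₁ r) rfl
    have e₂ := ih _ ?_ (s.append (.cons h₂ .nil)) rfl
    · rw [← hw₂]
      simp only [SimpleGraph.Walk.comp, SimpleGraph.Walk.comp_append, Category.assoc] at e₁ e₂ ⊢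
      rw [e₂, Category.comp_id, e₁]
    all_goals
      rw [← hw₂]
      simp only [SimpleGraph.Walk.stepSum, SimpleGraph.Walk.stepSum_append, hwt]
      omega
  have hlow : ∀ v ∈ w₂.support, v.2 ≤ t.2 := fun v hv => by
    have := hsupp v (by simp [hv])
    rw [Prod.Lex.toLex_le_toLex] at this
    grind
  have hN := stepSum_rayCrossing_of_top w₂ hmem hlow
  have ha := hsupp a (by simp)
  have hb := hsupp b (by simp)
  rw [Prod.Lex.toLex_le_toLex] at ha hb
  obtain ⟨x, y, rfl⟩ : ∃ x y, t = (x + 1, y + 1) := ⟨t.1 - 1, t.2 - 1, by simp⟩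
  have ha' : a = (x, y + 1) ∨ a = (x + 1, y) := by
    rcases h₁ with (⟨h, -⟩ | ⟨h, -⟩) | (⟨h, -⟩ | ⟨h, -⟩) <;>
      simp only [Prod.ext_iff] at h ⊢ <;> grind
  have hb' : b = (x, y + 1) ∨ b = (x + 1, y) := by
    rcases h₂ with (⟨h, -⟩ | ⟨h, -⟩) | (⟨h, -⟩ | ⟨h, -⟩) <;>
      simp only [Prod.ext_iff] at h ⊢ <;> grind
  by_cases hab : a = b
  · subst hab
    have e := ih _ (by
      simp only [SimpleGraph.Walk.stepSum, SimpleGraph.Walk.stepSum_append, hwt]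
      omega) w₂ rfl
    simp only [SimpleGraph.Walk.comp, SimpleGraph.Walk.comp_append, Category.comp_id]
    rw [e, Category.id_comp, hinv]
  have hcell : (x, y) ∈ S := by
    by_contra hc
    have := hwind _ hc _ (SimpleGraph.Walk.cons h₁ (w₂.append (.cons h₂ .nil)))
    simp only [SimpleGraph.Walk.stepSum, SimpleGraph.Walk.stepSum_append] at this
    simp only [add_sub_cancel_right] at hN
    rw [hN] at this
    rcases ha' with rfl | rfl <;> rcases hb' with rfl | rfl <;> simp [rayCrossing] at this hab
  -- Push the corner `t` across the cell `(x, y)`.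
  have hxy := hS _ hcell
  have hc₁ : (gridGraph S).Adj (x, y) (x, y + 1) := .inl (.inr ⟨rfl, .inl hcell⟩)
  have hc₂ : (gridGraph S).Adj (x, y) (x + 1, y) := .inl (.inl ⟨rfl, .inl hcell⟩)
  have hca : (gridGraph S).Adj (x, y) a := by rcases ha' with rfl | rfl <;> assumption
  have hcb : (gridGraph S).Adj (x, y) b := by rcases hb' with rfl | rfl <;> assumption
  have e := ih _ ?_ (SimpleGraph.Walk.cons hca (w₂.append (.cons hcb.symm .nil))) rfl
  · simp only [SimpleGraph.Walk.comp, SimpleGraph.Walk.comp_append, Category.comp_id] at e ⊢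
    have e' : w₂.comp hom = hom hca.symm ≫ hom hcb := by
      have := congrArg (fun z => hom hca.symm ≫ z ≫ hom hcb) e
      simp only [Category.assoc, hinv, Category.comp_id, Category.id_comp] at this
      rw [← this, ← Category.assoc, hinv, Category.id_comp]
    rw [e', ← hsq _ hcell a b _ rfl (by grind) h₁.symm h₂.symm, Category.assoc, hinv,
      Category.comp_id, hinv]
  · simp only [SimpleGraph.Walk.stepSum, SimpleGraph.Walk.stepSum_append, hwt]
    simp only at hxy
    omega

end GridGraph

section BoundaryGraph

/-- `BoundaryEdge Q a u v` says that `v` is the right or upper neighbour of `u`, that the edge from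
`u` to `v` separates a cell in `Q` from a cell outside `Q`, and that it is not the horizontal edge
starting at `a`. -/
def BoundaryEdge (Q : Set (ℤ × ℤ)) (a u v : ℤ × ℤ) : Prop :=
  (v = (u.1 + 1, u.2) ∧ u ≠ a ∧ ¬(u ∈ Q ↔ (u.1, u.2 - 1) ∈ Q)) ∨
    (v = (u.1, u.2 + 1) ∧ ¬(u ∈ Q ↔ (u.1 - 1, u.2) ∈ Q))

/-- The boundary of a set of cells of the integer grid, with one horizontal edge removed. -/
def boundaryGraph (Q : Set (ℤ × ℤ)) (a : ℤ × ℤ) : SimpleGraph (ℤ × ℤ) where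
  Adj u v := BoundaryEdge Q a u v ∨ BoundaryEdge Q a v u
  symm := ⟨fun _ _ h => h.symm⟩
  loopless := ⟨fun u h => by
    rcases h with (⟨h, -⟩ | ⟨h, -⟩) | (⟨h, -⟩ | ⟨h, -⟩) <;> simp [Prod.ext_iff] at h⟩

theorem boundaryGraph_le (Q : Set (ℤ × ℤ)) (a : ℤ × ℤ) : boundaryGraph Q a ≤ gridGraph Q := by
  have key : ∀ u v, BoundaryEdge Q a u v → GridEdge Q u v := by
    rintro u v (⟨h, -, h'⟩ | ⟨h, h'⟩)
    · exact .inl ⟨h, by tauto⟩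
    · exact .inr ⟨h, by tauto⟩
  intro u v h
  exact h.imp (key u v) (key v u)

/-- The end points of a horizontal edge in the boundary of a finite set of cells are joined by the
rest of the boundary. -/
theorem boundaryGraph_reachable {Q : Set (ℤ × ℤ)} (hQ : Q.Finite) {a : ℤ × ℤ} (ha : a ∈ Q)
    (ha' : (a.1, a.2 - 1) ∉ Q) : (boundaryGraph Q a).Reachable a (a.1 + 1, a.2) := by
  classical
  by_contra hcon
  set G := boundaryGraph Q a
  have hfin : {v | G.Reachable a v}.Finite := by
    refine Set.Finite.subset (((((hQ.union (hQ.image fun c => (c.1 + 1, c.2))).union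
      (hQ.image fun c => (c.1, c.2 + 1))).union
      (hQ.image fun c => (c.1 + 1, c.2 + 1))).union (Set.finite_singleton a))) ?_
    rintro v ⟨w⟩
    cases hw : w.reverse with
    | nil => exact .inr rfl
    | cons h p =>
      left
      have h := boundaryGraph_le Q a h
      simp only [Set.mem_union, Set.mem_image, Prod.exists, Prod.ext_iff]
      rcases h with (⟨h, h' | h'⟩ | ⟨h, h' | h'⟩) | (⟨h, h' | h'⟩ | ⟨h, h' | h'⟩) <;>
        simp only [Prod.ext_iff] at h
      · exact .inl (.inl (.inl h'))
      · exact .inl (.inr ⟨_, _, h', by simp⟩)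
      · exact .inl (.inl (.inl h'))
      · exact .inl (.inl (.inr ⟨_, _, h', by simp⟩))
      · exact .inl (.inl (.inr ⟨_, _, h', by simp [h]⟩))
      · exact .inr ⟨_, _, h', by simp [h]⟩
      · exact .inl (.inr ⟨_, _, h', by simp [h]⟩)
      · exact .inr ⟨_, _, h', by simp [h]⟩
  set s := hfin.toFinset
  have hs : ∀ v, v ∈ s ↔ G.Reachable a v := fun v => by simp [s]
  set q : ℤ × ℤ → ZMod 2 := fun v => if v ∈ Q then 1 else 0 with hq
  set h : ℤ × ℤ → ZMod 2 := fun v => if G.Adj v (v.1 + 1, v.2) then 1 else 0 with hh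
  set k : ℤ × ℤ → ZMod 2 := fun v => if G.Adj v (v.1, v.2 + 1) then 1 else 0 with hk
  have hh' : ∀ v, h v = q v + q (v.1, v.2 - 1) + if v = a then 1 else 0 := by
    intro v
    have : G.Adj v (v.1 + 1, v.2) ↔ v ≠ a ∧ ¬(v ∈ Q ↔ (v.1, v.2 - 1) ∈ Q) := by
      simp [G, boundaryGraph, BoundaryEdge, Prod.ext_iff]
      omega
    simp only [hh, hq, this]
    by_cases hva : v = a
    · subst hva
      simp [ha, ha', CharTwo.add_self_eq_zero]
    · by_cases h1 : v ∈ Q <;> by_cases h2 : (v.1, v.2 - 1) ∈ Q <;>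
        simp [hva, h1, h2, CharTwo.add_self_eq_zero]
  have hk' : ∀ v, k v = q v + q (v.1 - 1, v.2) := by
    intro v
    have : G.Adj v (v.1, v.2 + 1) ↔ ¬(v ∈ Q ↔ (v.1 - 1, v.2) ∈ Q) := by
      simp [G, boundaryGraph, BoundaryEdge, Prod.ext_iff]
      omega
    simp only [hk, hq, this]
    by_cases h1 : v ∈ Q <;> by_cases h2 : (v.1 - 1, v.2) ∈ Q <;>
      simp [h1, h2, CharTwo.add_self_eq_zero]
  have e₁ : ∑ v ∈ s, h v = ∑ v ∈ s, h (v.1 - 1, v.2) := by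
    refine Finset.sum_bij_ne_zero (fun v _ _ => (v.1 + 1, v.2)) ?_ ?_ ?_ ?_
    · intro v hv hne
      have hadj : G.Adj v (v.1 + 1, v.2) := by by_contra hc; simp [hh, hc] at hne
      exact (hs _).2 (((hs _).1 hv).trans hadj.reachable)
    · intro v _ _ v' _ _ e
      simpa [Prod.ext_iff] using e
    · intro v hv hne
      have hadj : G.Adj (v.1 - 1, v.2) v := by by_contra hc; simp [hh, hc] at hne
      exact ⟨(v.1 - 1, v.2), (hs _).2 (((hs _).1 hv).trans hadj.symm.reachable), hne, by simp⟩
    · intro v _ _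
      simp
  have e₂ : ∑ v ∈ s, k v = ∑ v ∈ s, k (v.1, v.2 - 1) := by
    refine Finset.sum_bij_ne_zero (fun v _ _ => (v.1, v.2 + 1)) ?_ ?_ ?_ ?_
    · intro v hv hne
      have hadj : G.Adj v (v.1, v.2 + 1) := by by_contra hc; simp [hk, hc] at hne
      exact (hs _).2 (((hs _).1 hv).trans hadj.reachable)
    · intro v _ _ v' _ _ e
      simpa [Prod.ext_iff] using e
    · intro v hv hne
      have hadj : G.Adj (v.1, v.2 - 1) v := by by_contra hc; simp [hk, hc] at hne
      exact ⟨(v.1, v.2 - 1), (hs _).2 (((hs _).1 hv).trans hadj.symm.reachable), hne, by simp⟩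
    · intro v _ _
      simp
  have two : ∀ z : ZMod 2, z + z = 0 := by decide
  have e₃ : ∑ v ∈ s, (h v + h (v.1 - 1, v.2) + (k v + k (v.1, v.2 - 1))) = 0 := by
    rw [Finset.sum_add_distrib, Finset.sum_add_distrib, Finset.sum_add_distrib, ← e₁, ← e₂, two,
      two, add_zero]
  have e₄ : ∀ v ∈ s, h v + h (v.1 - 1, v.2) + (k v + k (v.1, v.2 - 1)) = if v = a then 1 else 0 := by
    intro v hv
    have hne : ((v.1 - 1, v.2) : ℤ × ℤ) ≠ a := by
      intro e
      refine hcon ?_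
      rw [← hs]
      convert hv using 1
      simp [← e]
    simp only [hh', hk', hne, if_false, add_zero]
    linear_combination two (q v) + two (q (v.1, v.2 - 1)) + two (q (v.1 - 1, v.2)) +
      two (q (v.1 - 1, v.2 - 1))
  rw [Finset.sum_congr rfl e₄, Finset.sum_ite_eq' s a, if_pos ((hs a).2 (.refl a))] at e₃
  exact one_ne_zero e₃

end BoundaryGraph

section Realization

theorem Path.coe_trans_mem {X : Type*} [TopologicalSpace X] {O s : Set X} {x y z : O}
    {γ : Path x y} {γ' : Path y z} (h : ∀ t, (γ t : X) ∈ s) (h' : ∀ t, (γ' t : X) ∈ s)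
    (t : unitInterval) : (γ.trans γ' t : X) ∈ s := by
  rw [Path.trans_apply]
  split_ifs
  exacts [h _, h' _]

theorem Path.homotopic_of_convex {E : Type*} [AddCommGroup E] [Module ℝ E] [TopologicalSpace E]
    [IsTopologicalAddGroup E] [ContinuousSMul ℝ E] {O s : Set E} (hs : Convex ℝ s) (hsO : s ⊆ O)
    {x y : O} (γ γ' : Path x y) (hγ : ∀ t, (γ t : E) ∈ s) (hγ' : ∀ t, (γ' t : E) ∈ s) :
    γ.Homotopic γ' := by
  have hmem : ∀ p : unitInterval × unitInterval,
      (1 - (p.1 : ℝ)) • (γ p.2 : E) + (p.1 : ℝ) • (γ' p.2 : E) ∈ s := fun p =>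
    hs (hγ _) (hγ' _) (sub_nonneg.2 p.1.2.2) p.1.2.1 (by ring)
  refine ⟨{ toFun := fun p => ⟨_, hsO (hmem p)⟩
            continuous_toFun := by fun_prop
            map_zero_left := fun t => by simp
            map_one_left := fun t => by simp
            prop' := ?_ }⟩
  rintro t z (rfl | rfl) <;> simp [← add_smul]

theorem exists_path_mem_segment {E : Type*} [AddCommGroup E] [Module ℝ E] [TopologicalSpace E]
    [IsTopologicalAddGroup E] [ContinuousSMul ℝ E] {O : Set E} {x y : O}
    (h : segment ℝ (x : E) y ⊆ O) : ∃ γ : Path x y, ∀ t, (γ t : E) ∈ segment ℝ (x : E) y := by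
  have hmem : ∀ t : unitInterval,
      (1 - (t : ℝ)) • (x : E) + (t : ℝ) • (y : E) ∈ segment ℝ (x : E) y := fun t =>
    ⟨_, _, sub_nonneg.2 t.2.2, t.2.1, by ring, rfl⟩
  exact ⟨{ toFun := fun t => ⟨_, h (hmem t)⟩
           continuous_toFun := by fun_prop
           source' := by simp
           target' := by simp }, hmem⟩

/-- The vertex `v` of the grid of mesh `1 / n`. -/
noncomputable def gridPoint (n : ℕ) (v : ℤ × ℤ) : ℝ × ℝ := (v.1 / n, v.2 / n)

/-- The closed cell with lower left corner `c` in the grid of mesh `1 / n`. -/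
def gridCell (n : ℕ) (c : ℤ × ℤ) : Set (ℝ × ℝ) :=
  Set.Icc (gridPoint n c) (gridPoint n (c.1 + 1, c.2 + 1))

theorem mem_gridCell {n : ℕ} (hn : 0 < n) {c : ℤ × ℤ} {z : ℝ × ℝ} :
    z ∈ gridCell n c ↔ ((c.1 : ℝ) ≤ z.1 * n ∧ z.1 * n ≤ c.1 + 1) ∧
      ((c.2 : ℝ) ≤ z.2 * n ∧ z.2 * n ≤ c.2 + 1) := by
  have hn' : (0 : ℝ) < n := by exact_mod_cast hn
  simp only [gridCell, gridPoint, Set.mem_Icc, Prod.le_def, div_le_iff₀ hn', le_div_iff₀ hn']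
  push_cast
  tauto

theorem convex_gridCell (n : ℕ) (c : ℤ × ℤ) : Convex ℝ (gridCell n c) := convex_Icc _ _

theorem gridPoint_mem_gridCell {n : ℕ} (hn : 0 < n) {c v : ℤ × ℤ} (h₁ : v.1 = c.1 ∨ v.1 = c.1 + 1)
    (h₂ : v.2 = c.2 ∨ v.2 = c.2 + 1) : gridPoint n v ∈ gridCell n c := by
  have hn' : (n : ℝ) ≠ 0 := by exact_mod_cast hn.ne'
  rw [mem_gridCell hn]
  simp only [gridPoint, div_mul_cancel₀ _ hn']
  rcases h₁ with h₁ | h₁ <;> rcases h₂ with h₂ | h₂ <;> simp [h₁, h₂]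

/-- A side of a cell in `S` is contained in that cell. -/
theorem exists_segment_subset_gridCell {n : ℕ} (hn : 0 < n) {S : Set (ℤ × ℤ)} {u v : ℤ × ℤ}
    (h : (gridGraph S).Adj u v) :
    ∃ c ∈ S, segment ℝ (gridPoint n u) (gridPoint n v) ⊆ gridCell n c := by
  have key : ∀ c ∈ S, (u.1 = c.1 ∨ u.1 = c.1 + 1) → (u.2 = c.2 ∨ u.2 = c.2 + 1) →
      (v.1 = c.1 ∨ v.1 = c.1 + 1) → (v.2 = c.2 ∨ v.2 = c.2 + 1) →
      ∃ c ∈ S, segment ℝ (gridPoint n u) (gridPoint n v) ⊆ gridCell n c := fun c hc h₁ h₂ h₃ h₄ =>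
    ⟨c, hc, (convex_gridCell n c).segment_subset (gridPoint_mem_gridCell hn h₁ h₂)
      (gridPoint_mem_gridCell hn h₃ h₄)⟩
  rcases h with (⟨rfl, h | h⟩ | ⟨rfl, h | h⟩) | (⟨rfl, h | h⟩ | ⟨rfl, h | h⟩) <;>
    exact key _ h (by simp) (by simp) (by simp) (by simp)

/-- A path along a subgraph of the sides of the cells in `S` between neighbouring vertices is
homotopic to the side joining them, provided that no closed walk winds around a cell not
in `S`. -/
theorem exists_path_homotopic_side {O P : Set (ℝ × ℝ)} {n : ℕ} (hn : 0 < n) {S : Set (ℤ × ℤ)}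
    (hS : ∀ c ∈ S, 0 ≤ c.1 ∧ 0 ≤ c.2) (hSO : ∀ c ∈ S, gridCell n c ⊆ O)
    (hwind : ∀ c ∉ S, ∀ (u : ℤ × ℤ) (w : (gridGraph S).Walk u u), w.stepSum (rayCrossing c) = 0)
    {Γ : SimpleGraph (ℤ × ℤ)} (hΓ : Γ ≤ gridGraph S)
    (hP : ∀ u v, Γ.Adj u v → segment ℝ (gridPoint n u) (gridPoint n v) ⊆ P) {a b : ℤ × ℤ}
    (haP : gridPoint n a ∈ P) (hab : Γ.Reachable a b) (hadj : (gridGraph S).Adj a b) {x y : O}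
    (hx : (x : ℝ × ℝ) = gridPoint n a) (hy : (y : ℝ × ℝ) = gridPoint n b) :
    ∃ γ : Path x y, (∀ t, (γ t : ℝ × ℝ) ∈ P) ∧
      ∀ δ : Path x y, (∀ t, (δ t : ℝ × ℝ) ∈ segment ℝ (x : ℝ × ℝ) y) → γ.Homotopic δ := by
  classical
  obtain ⟨o, -⟩ : ∃ o : O, True := ⟨x, trivial⟩
  set pt : ℤ × ℤ → O := fun v => if h : gridPoint n v ∈ O then ⟨_, h⟩ else o with hpt
  have hpt' : ∀ v, gridPoint n v ∈ O → (pt v : ℝ × ℝ) = gridPoint n v := fun v hv => by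
    simp [hpt, hv]
  obtain rfl : x = pt a := Subtype.ext (hx.trans (hpt' a (hx ▸ x.2)).symm)
  obtain rfl : y = pt b := Subtype.ext (hy.trans (hpt' b (hy ▸ y.2)).symm)
  have hval : ∀ {u v}, (gridGraph S).Adj u v → (pt u : ℝ × ℝ) = gridPoint n u := by
    intro u v h
    obtain ⟨c, hc, hseg⟩ := exists_segment_subset_gridCell hn h
    exact hpt' u (hSO c hc (hseg (left_mem_segment ℝ _ _)))
  have hedge : ∀ u v, (gridGraph S).Adj u v →
      ∃ γ : Path (pt u) (pt v), ∀ t, (γ t : ℝ × ℝ) ∈ segment ℝ (gridPoint n u) (gridPoint n v) := by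
    intro u v h
    obtain ⟨c, hc, hseg⟩ := exists_segment_subset_gridCell hn h
    rw [← hval h, ← hval h.symm] at hseg ⊢
    exact exists_path_mem_segment (hseg.trans (hSO c hc))
  choose e he using hedge
  let hom (u v : ℤ × ℤ) (h : (gridGraph S).Adj u v) :
      (⟨pt u⟩ : FundamentalGroupoid O) ⟶ ⟨pt v⟩ := FundamentalGroupoid.fromPath (.mk (e u v h))
  have hclosed : ∀ {u : ℤ × ℤ} (w : (gridGraph S).Walk u u), w.comp (fun {u v} => hom u v) =
      CategoryTheory.CategoryStruct.id (⟨pt u⟩ : FundamentalGroupoid O) := by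
    intro u w
    refine comp_closed_walk_eq_id hS hwind (fun {u v} => hom u v) ?_ ?_ w
    · intro u v h h'
      obtain ⟨c, hc, hseg⟩ := exists_segment_subset_gridCell hn h
      refine Path.Homotopic.Quotient.eq.2 (Path.homotopic_of_convex
        (γ := (e u v h).trans (e v u h')) (γ' := .refl _) (convex_gridCell n c) (hSO c hc)
        (Path.coe_trans_mem (fun t => hseg (he u v h t)) fun t => hseg ?_) fun t => hseg ?_)
      · rw [segment_symm]
        exact he v u h' t
      · simpa [hval h] using left_mem_segment ℝ _ _
    · rintro c hc a b d rfl hab h₁ h₂ h₃ h₄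
      have hmem : ∀ u v (h : (gridGraph S).Adj u v), (u.1 = c.1 ∨ u.1 = c.1 + 1) →
          (u.2 = c.2 ∨ u.2 = c.2 + 1) → (v.1 = c.1 ∨ v.1 = c.1 + 1) →
          (v.2 = c.2 ∨ v.2 = c.2 + 1) → ∀ t, (e u v h t : ℝ × ℝ) ∈ gridCell n c :=
        fun u v h h₁ h₂ h₃ h₄ t => (convex_gridCell n c).segment_subset
          (gridPoint_mem_gridCell hn h₁ h₂) (gridPoint_mem_gridCell hn h₃ h₄) (he u v h t)
      refine Path.Homotopic.Quotient.eq.2 (Path.homotopic_of_convex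
        (γ := (e _ _ h₁).trans (e _ _ h₂)) (γ' := (e _ _ h₃).trans (e _ _ h₄))
        (convex_gridCell n c) (hSO c hc)
        (Path.coe_trans_mem (hmem _ _ _ ?_ ?_ ?_ ?_) (hmem _ _ _ ?_ ?_ ?_ ?_))
        (Path.coe_trans_mem (hmem _ _ _ ?_ ?_ ?_ ?_) (hmem _ _ _ ?_ ?_ ?_ ?_))) <;>
        rcases hab with ⟨rfl, rfl⟩ | ⟨rfl, rfl⟩ <;> simp
  have hwalk : ∀ {u v : ℤ × ℤ} (r : Γ.Walk u v), gridPoint n u ∈ P → gridPoint n u ∈ O →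
      ∃ (γ : Path (pt u) (pt v)) (w : (gridGraph S).Walk u v), (∀ t, (γ t : ℝ × ℝ) ∈ P) ∧
        FundamentalGroupoid.fromPath (.mk γ) = w.comp (fun {u v} => hom u v) := by
    intro u v r
    induction r with
    | nil =>
      intro h h'
      exact ⟨.refl _, .nil, fun t => by simpa [hpt' _ h'] using h, rfl⟩
    | @cons u v _ h p ih =>
      intro hu _
      have h' := hΓ h
      obtain ⟨γ, w, hγ, hw⟩ := ih (hP _ _ h (right_mem_segment ℝ _ _))
        (hval h'.symm ▸ (pt v).2)
      refine ⟨(e u v h').trans γ, .cons h' w,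
        Path.coe_trans_mem (fun t => hP _ _ h (he u v h' t)) hγ, ?_⟩
      rw [SimpleGraph.Walk.comp, ← hw]
      rfl
  obtain ⟨r⟩ := hab
  obtain ⟨γ, w, hγ, hw⟩ := hwalk r haP (hx ▸ (pt a).2)
  refine ⟨γ, hγ, fun δ hδ => ?_⟩
  have hcl := hclosed (w.append (.cons hadj.symm .nil))
  rw [SimpleGraph.Walk.comp_append, ← hw] at hcl
  obtain ⟨c, hc, hseg⟩ := exists_segment_subset_gridCell hn hadj
  have hδ' : δ.Homotopic (e a b hadj) := by
    refine Path.homotopic_of_convex (convex_gridCell n c) (hSO c hc) _ _ (fun t => hseg ?_)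
      fun t => hseg (he a b hadj t)
    rw [← hx, ← hy]
    exact hδ t
  have hback : ((e b a hadj.symm).trans (e a b hadj)).Homotopic (.refl _) := by
    refine Path.homotopic_of_convex (convex_gridCell n c) (hSO c hc) _ _
      (Path.coe_trans_mem (fun t => hseg ?_) fun t => hseg (he a b hadj t)) fun t => hseg ?_
    · rw [segment_symm]
      exact he b a _ t
    · simpa [hy] using right_mem_segment ℝ _ _
  have hloop : (γ.trans (e b a hadj.symm)).Homotopic (.refl _) := by
    refine Path.Homotopic.Quotient.exact (Eq.trans ?_ hcl)
    simp only [SimpleGraph.Walk.comp, CategoryTheory.Category.comp_id]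
    rfl
  refine Path.Homotopic.trans ?_ hδ'.symm
  exact ((Path.Homotopic.trans_refl γ).symm.trans
    (((Path.Homotopic.refl γ).hcomp hback).symm.trans
      ((Path.Homotopic.trans_assoc _ _ _).symm.trans
        ((hloop.hcomp (.refl _)).trans (Path.Homotopic.refl_trans _)))))

end Realization

section Bypass

/-- Cells meeting a common point of a set `E` that avoids all cells in `S` have the same winding
number. -/
theorem stepSum_rayCrossing_eq_of_mem {n : ℕ} (hn : 0 < n) {S : Set (ℤ × ℤ)} {E : Set (ℝ × ℝ)}
    (hSE : ∀ c ∈ S, Disjoint (gridCell n c) E) {z : ℝ × ℝ} (hz : z ∈ E) {c d : ℤ × ℤ}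
    (hc : z ∈ gridCell n c) (hd : z ∈ gridCell n d) {u : ℤ × ℤ} (w : (gridGraph S).Walk u u) :
    w.stepSum (rayCrossing c) = w.stepSum (rayCrossing d) := by
  have hnot : ∀ c, z ∈ gridCell n c → c ∉ S := fun c hc hcS =>
    Set.disjoint_left.1 (hSE c hcS) hc hz
  have near : ∀ {i j : ℤ} {x : ℝ}, (i : ℝ) ≤ x → x ≤ i + 1 → (j : ℝ) ≤ x → x ≤ j + 1 →
      j = i ∨ j = i + 1 ∨ i = j + 1 := by
    intro i j x h₁ h₂ h₃ h₄
    have : (i : ℝ) ≤ j + 1 := h₁.trans h₄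
    have : (j : ℝ) ≤ i + 1 := h₃.trans h₂
    norm_cast at *
    omega
  obtain ⟨i, j⟩ := c
  obtain ⟨k, l⟩ := d
  have hc' := (mem_gridCell hn).1 hc
  have hd' := (mem_gridCell hn).1 hd
  have hm : z ∈ gridCell n (k, j) := (mem_gridCell hn).2 ⟨hd'.1, hc'.2⟩
  trans w.stepSum (rayCrossing (k, j))
  · rcases near hc'.1.1 hc'.1.2 hd'.1.1 hd'.1.2 with h | h | h <;> simp only at h <;> subst h
    · rfl
    · exact stepSum_rayCrossing_right (hnot _ hc) (hnot _ hm) w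
    · exact (stepSum_rayCrossing_right (hnot _ hm) (hnot _ hc) w).symm
  · rcases near hc'.2.1 hc'.2.2 hd'.2.1 hd'.2.2 with h | h | h <;> simp only at h <;> subst h
    · rfl
    · exact stepSum_rayCrossing_up (hnot _ hm) (hnot _ hd) w
    · exact (stepSum_rayCrossing_up (hnot _ hd) (hnot _ hm) w).symm

theorem eventually_mem_floor_cell (x : ℝ) :
    ∀ᶠ y : ℝ in nhds x, (⌊y⌋ : ℝ) ≤ x ∧ x ≤ ⌊y⌋ + 1 := by
  have h₁ : ∀ᶠ y : ℝ in nhds x, y < ⌊x⌋ + 1 := eventually_lt_nhds (Int.lt_floor_add_one x)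
  have h₂ : ∀ᶠ y : ℝ in nhds x, (⌈x⌉ : ℝ) - 1 < y :=
    eventually_gt_nhds (by linarith [Int.ceil_lt_add_one x])
  filter_upwards [h₁, h₂] with y hy₁ hy₂
  have e₁ : ⌊y⌋ < ⌊x⌋ + 1 := Int.floor_lt.2 (by push_cast; exact hy₁)
  have e₂ : ⌈x⌉ - 1 ≤ ⌊y⌋ := Int.le_floor.2 (by push_cast; exact hy₂.le)
  exact ⟨(Int.cast_le.2 (Int.lt_add_one_iff.1 e₁)).trans (Int.floor_le x),
    (Int.le_ceil x).trans (by exact_mod_cast sub_le_iff_le_add.1 e₂)⟩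

/-- A closed walk along sides of cells in `S` does not wind around the cells meeting a preconnected
set that avoids the cells in `S` and that contains a point outside the unit square. -/
theorem stepSum_rayCrossing_eq_zero {n : ℕ} (hn : 0 < n) {S : Set (ℤ × ℤ)} {E : Set (ℝ × ℝ)}
    (hS : ∀ c ∈ S, 0 ≤ c.1 ∧ c.1 < n ∧ 0 ≤ c.2 ∧ c.2 < n)
    (hSE : ∀ c ∈ S, Disjoint (gridCell n c) E) (hE : IsPreconnected E)
    (htop : ((0, 2) : ℝ × ℝ) ∈ E) {z : ℝ × ℝ} (hz : z ∈ E) {c : ℤ × ℤ}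
    (hc : z ∈ gridCell n c) {u : ℤ × ℤ} (w : (gridGraph S).Walk u u) :
    w.stepSum (rayCrossing c) = 0 := by
  set fl : ℝ × ℝ → ℤ × ℤ := fun z => (⌊z.1 * n⌋, ⌊z.2 * n⌋) with hfl
  have hmem : ∀ z, z ∈ gridCell n (fl z) := fun z => (mem_gridCell hn).2
    ⟨⟨Int.floor_le _, (Int.lt_floor_add_one _).le⟩, Int.floor_le _, (Int.lt_floor_add_one _).le⟩
  have hcont : ContinuousOn (fun z => w.stepSum (rayCrossing (fl z))) E := by
    intro z hz
    refine ContinuousAt.continuousWithinAt ?_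
    refine (continuousAt_const (y := w.stepSum (rayCrossing (fl z)))).congr ?_
    have c₁ : Filter.Tendsto (fun y : ℝ × ℝ => y.1 * n) (nhds z) (nhds (z.1 * n)) :=
      (Continuous.tendsto (by fun_prop) z)
    have c₂ : Filter.Tendsto (fun y : ℝ × ℝ => y.2 * n) (nhds z) (nhds (z.2 * n)) :=
      (Continuous.tendsto (by fun_prop) z)
    filter_upwards [c₁.eventually (eventually_mem_floor_cell _),
      c₂.eventually (eventually_mem_floor_cell _)] with y h₁ h₂
    exact stepSum_rayCrossing_eq_of_mem hn hSE hz (hmem z) ((mem_gridCell hn).2 ⟨h₁, h₂⟩) w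
  rw [stepSum_rayCrossing_eq_of_mem hn hSE hz hc (hmem z)]
  rw [hE.constant hcont hz htop]
  refine stepSum_rayCrossing_outside hS ?_ w
  have : ⌊(2 : ℝ) * n⌋ = 2 * n := by
    rw [Int.floor_eq_iff]
    push_cast
    constructor <;> linarith
  simp only [hfl, this]
  omega

theorem dist_le_of_mem_gridCell {n : ℕ} (hn : 0 < n) {c : ℤ × ℤ} {z z' : ℝ × ℝ}
    (hz : z ∈ gridCell n c) (hz' : z' ∈ gridCell n c) : dist z z' ≤ 1 / n := by
  have hn' : (0 : ℝ) < n := by exact_mod_cast hn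
  rw [mem_gridCell hn] at hz hz'
  have key : ∀ {x y i : ℝ}, i ≤ x * n → x * n ≤ i + 1 → i ≤ y * n → y * n ≤ i + 1 →
      dist x y ≤ 1 / n := by
    intro x y i _ _ _ _
    rw [Real.dist_eq, abs_sub_le_iff, le_div_iff₀ hn', le_div_iff₀ hn', sub_mul, sub_mul]
    constructor <;> linarith
  exact max_le (key hz.1.1 hz.1.2 hz'.1.1 hz'.1.2) (key hz.2.1 hz.2.2 hz'.2.1 hz'.2.2)

/-- Let `D` and `R` be subsets of the unit square that meet its boundary only in `(t₀, 0) ∈ D`, and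
let `E` be a preconnected set reaching out of the square.  If `D` has distance more than `1 / n`
from `R` and `E`, then the bottom side can be deformed in the complement of `E` to a path that
avoids `D` and `R`. -/
theorem exists_path_bypass {O E D R : Set (ℝ × ℝ)} {n : ℕ} (hn : 0 < n) {t₀ : ℝ}
    (h₀ : 0 < t₀) (h₁ : t₀ < 1) (hnt : ∀ k : ℤ, t₀ * n ≠ k) (hE : IsPreconnected E)
    (htop : ((0, 2) : ℝ × ℝ) ∈ E) (hO : Set.Icc 0 1 \ E ⊆ O) (hD : (t₀, 0) ∈ D)
    (hDE : ∀ z ∈ D, ∀ z' ∈ E, 1 / n < dist z z') (hDR : ∀ z ∈ D, ∀ z' ∈ R, 1 / n < dist z z')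
    (hbd : ∀ z ∈ D ∪ R, z.1 = 0 ∨ z.1 = 1 ∨ z.2 = 0 ∨ z.2 = 1 → z = (t₀, 0)) :
    ∃ l r : ℝ, 0 ≤ l ∧ l < t₀ ∧ t₀ < r ∧ r ≤ 1 ∧ ∃ (hl : (l, 0) ∈ O) (hr : (r, 0) ∈ O),
      ∃ γ : Path (⟨(l, 0), hl⟩ : O) ⟨(r, 0), hr⟩, (∀ t, (γ t : ℝ × ℝ) ∈ Set.Icc 0 1 \ (D ∪ R)) ∧
        ∀ δ : Path (⟨(l, 0), hl⟩ : O) ⟨(r, 0), hr⟩,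
          (∀ t, (δ t : ℝ × ℝ) ∈ segment ℝ ((l, 0) : ℝ × ℝ) (r, 0)) → γ.Homotopic δ := by
  have hn' : (0 : ℝ) < n := by exact_mod_cast hn
  set B : ℤ × ℤ → Prop := fun c => 0 ≤ c.1 ∧ c.1 < n ∧ 0 ≤ c.2 ∧ c.2 < n with hB
  set S : Set (ℤ × ℤ) := {c | B c ∧ Disjoint (gridCell n c) E} with hS
  set Q : Set (ℤ × ℤ) := {c | B c ∧ (gridCell n c ∩ D).Nonempty} with hQ
  have hQS : Q ⊆ S := by
    rintro c ⟨hc, z, hz, hzD⟩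
    refine ⟨hc, Set.disjoint_left.2 fun z' hz' hz'E => ?_⟩
    exact (dist_le_of_mem_gridCell hn hz hz').not_gt (hDE z hzD z' hz'E)
  have hQfin : Q.Finite := by
    refine ((Set.finite_Ico (0 : ℤ) n).prod (Set.finite_Ico (0 : ℤ) n)).subset ?_
    rintro c ⟨⟨h₁, h₂, h₃, h₄⟩, -⟩
    exact ⟨⟨h₁, h₂⟩, h₃, h₄⟩
  have hSI : ∀ c ∈ S, gridCell n c ⊆ Set.Icc 0 1 := by
    rintro c ⟨⟨b₁, b₂, b₃, b₄⟩, -⟩ z hz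
    rw [mem_gridCell hn] at hz
    have b₁' : (0 : ℝ) ≤ c.1 := by exact_mod_cast b₁
    have b₂' : (c.1 : ℝ) + 1 ≤ n := by exact_mod_cast b₂
    have b₃' : (0 : ℝ) ≤ c.2 := by exact_mod_cast b₃
    have b₄' : (c.2 : ℝ) + 1 ≤ n := by exact_mod_cast b₄
    refine ⟨⟨?_, ?_⟩, ?_, ?_⟩ <;> simp only [Prod.fst_zero, Prod.snd_zero, Prod.fst_one,
      Prod.snd_one] <;> nlinarith
  have hSO : ∀ c ∈ S, gridCell n c ⊆ O := fun c hc z hz =>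
    hO ⟨hSI c hc hz, fun hzE => Set.disjoint_left.1 hc.2 hz hzE⟩
  have hwind : ∀ c ∉ S, ∀ (u : ℤ × ℤ) (w : (gridGraph S).Walk u u),
      w.stepSum (rayCrossing c) = 0 := by
    intro c hc u w
    by_cases hcB : B c
    · obtain ⟨z, hz, hzE⟩ := Set.not_disjoint_iff.1 fun h => hc ⟨hcB, h⟩
      exact stepSum_rayCrossing_eq_zero hn (fun c hc => hc.1) (fun c hc => hc.2) hE htop hzE hz w
    · exact stepSum_rayCrossing_outside (fun c hc => hc.1) hcB w
  set a : ℤ × ℤ := (⌊t₀ * n⌋, 0) with ha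
  have hfl : (⌊t₀ * n⌋ : ℝ) < t₀ * n := lt_of_le_of_ne (Int.floor_le _) (hnt _).symm
  have hfl' : t₀ * n < ⌊t₀ * n⌋ + 1 := Int.lt_floor_add_one _
  have haQ : a ∈ Q := by
    refine ⟨⟨Int.floor_nonneg.2 (by positivity), Int.floor_lt.2 ?_, le_rfl,
      Int.natCast_pos.2 hn⟩,
      (t₀, 0), (mem_gridCell hn).2 ⟨⟨hfl.le, hfl'.le⟩, by simp [ha]⟩, hD⟩
    push_cast
    nlinarith
  have hpt : gridPoint n a = ((⌊t₀ * n⌋ : ℝ) / n, (0 : ℝ)) := by simp [gridPoint, ha]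
  have hpt' : gridPoint n (a.1 + 1, a.2) =
      (((⌊t₀ * n⌋ : ℝ) + 1) / n, (0 : ℝ)) := by simp [gridPoint, ha]
  have hcell : ∀ z c c', c ∈ Q → c' ∉ Q → z ∈ gridCell n c → z ∈ gridCell n c' → z ∈ D ∪ R →
      ¬ B c' := by
    rintro z c c' ⟨-, y, hy, hyD⟩ hc' hz hz' (hzD | hzR) hB'
    · exact hc' ⟨hB', z, hz', hzD⟩
    · exact (dist_le_of_mem_gridCell hn hy hz).not_gt (hDR y hyD z hzR)
  have hcell' : ∀ z c c', ¬(c ∈ Q ↔ c' ∈ Q) → z ∈ gridCell n c → z ∈ gridCell n c' → z ∈ D ∪ R →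
      ¬(B c ↔ B c') := by
    intro z c c' hcc hz hz' hzDR
    by_cases hc : c ∈ Q <;> by_cases hc' : c' ∈ Q
    · exact absurd (iff_of_true hc hc') hcc
    · exact fun h => hcell z c c' hc hc' hz hz' hzDR (h.1 hc.1)
    · exact fun h => hcell z c' c hc' hc hz' hz hzDR (h.2 hc'.1)
    · exact absurd (iff_of_false hc hc') hcc
  have hedge : ∀ u v, BoundaryEdge Q a u v →
      segment ℝ (gridPoint n u) (gridPoint n v) ⊆ (D ∪ R)ᶜ := by
    intro u v h z hz hzDR
    have hsub : ∀ c : ℤ × ℤ, (u.1 = c.1 ∨ u.1 = c.1 + 1) → (u.2 = c.2 ∨ u.2 = c.2 + 1) →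
      (v.1 = c.1 ∨ v.1 = c.1 + 1) → (v.2 = c.2 ∨ v.2 = c.2 + 1) → z ∈ gridCell n c :=
      fun c h₁ h₂ h₃ h₄ => (convex_gridCell n c).segment_subset (gridPoint_mem_gridCell hn h₁ h₂)
        (gridPoint_mem_gridCell hn h₃ h₄) hz
    rcases h with ⟨rfl, hne, h⟩ | ⟨rfl, h⟩
    · have m₁ := hsub u (by simp) (by simp) (by simp) (by simp)
      have m₂ := hsub (u.1, u.2 - 1) (by simp) (by simp) (by simp) (by simp)
      have hB' := hcell' z _ _ h m₁ m₂ hzDR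
      rw [mem_gridCell hn] at m₁ m₂
      push_cast at m₁ m₂
      have hz2 : z.2 * n = u.2 := by linarith [m₁.2.1, m₂.2.2]
      have hu : u.2 = 0 ∨ u.2 = n := by simp only [hB] at hB'; omega
      have hz2' : z.2 = 0 ∨ z.2 = 1 := by
        rcases hu with hu | hu <;> rw [hu] at hz2
        · left; simpa [hn'.ne'] using hz2
        · right; simpa [hn'.ne'] using hz2
      have hzt := hbd z hzDR (.inr (.inr hz2'))
      subst hzt
      simp only [zero_mul] at hz2
      refine hne (Prod.ext ?_ (by exact_mod_cast hz2.symm))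
      refine (Int.floor_eq_iff.2 ⟨m₁.1.1, lt_of_le_of_ne m₁.1.2 ?_⟩).symm
      exact_mod_cast hnt (u.1 + 1)
    · have m₁ := hsub u (by simp) (by simp) (by simp) (by simp)
      have m₂ := hsub (u.1 - 1, u.2) (by simp) (by simp) (by simp) (by simp)
      have hB' := hcell' z _ _ h m₁ m₂ hzDR
      rw [mem_gridCell hn] at m₁ m₂
      push_cast at m₁ m₂
      have hz1 : z.1 * n = u.1 := by linarith [m₁.1.1, m₂.1.2]
      have hu : u.1 = 0 ∨ u.1 = n := by simp only [hB] at hB'; omega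
      have hz1' : z.1 = 0 ∨ z.1 = 1 := by
        rcases hu with hu | hu <;> rw [hu] at hz1
        · left; simpa [hn'.ne'] using hz1
        · right; simpa [hn'.ne'] using hz1
      have hzt := hbd z hzDR (hz1'.imp_right .inl)
      subst hzt
      exact hnt _ hz1
  have hmono : gridGraph Q ≤ gridGraph S := by
    have : ∀ u v, GridEdge Q u v → GridEdge S u v := fun u v h =>
      h.imp (And.imp_right (Or.imp (@hQS _) (@hQS _))) (And.imp_right (Or.imp (@hQS _) (@hQS _)))
    exact fun u v h => h.imp (this u v) (this v u)
  have haQ' : (a.1, a.2 - 1) ∉ Q := by simp [hQ, hB, ha]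
  have hl := hSO a (hQS haQ) (gridPoint_mem_gridCell hn (v := a) (by simp) (by simp))
  have hr := hSO a (hQS haQ) (gridPoint_mem_gridCell hn (v := (a.1 + 1, a.2)) (by simp) (by simp))
  rw [hpt] at hl
  rw [hpt'] at hr
  have hlt : (⌊t₀ * n⌋ : ℝ) / n < t₀ := (div_lt_iff₀ hn').2 hfl
  have hΓ := (boundaryGraph_le Q a).trans hmono
  have hside : ∀ u v, (boundaryGraph Q a).Adj u v →
      segment ℝ (gridPoint n u) (gridPoint n v) ⊆ Set.Icc 0 1 \ (D ∪ R) := by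
    intro u v h
    obtain ⟨c, hc, hseg⟩ := exists_segment_subset_gridCell hn (hΓ h)
    refine Set.subset_inter (hseg.trans (hSI c hc)) ?_
    exact h.elim (hedge u v) fun h => by rw [segment_symm]; exact hedge v u h
  obtain ⟨γ, hγ, hγ'⟩ := exists_path_homotopic_side (P := Set.Icc 0 1 \ (D ∪ R)) hn
    (fun c hc => ⟨hc.1.1, hc.1.2.2.1⟩) hSO
    hwind hΓ hside
    ⟨hSI a (hQS haQ) (gridPoint_mem_gridCell hn (.inl rfl) (.inl rfl)),
      fun h => hlt.ne (by simpa [hpt] using congrArg Prod.fst (hbd _ h (by simp [hpt])))⟩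
    (boundaryGraph_reachable hQfin haQ haQ')
    (.inl (.inl ⟨rfl, .inl (hQS haQ)⟩)) (x := ⟨_, hl⟩) (y := ⟨_, hr⟩) hpt.symm hpt'.symm
  refine ⟨_, _, ?_, hlt, (lt_div_iff₀ hn').2 hfl', (div_le_one hn').2 ?_, hl, hr, γ, hγ, hγ'⟩
  · have : (0 : ℝ) ≤ ⌊t₀ * n⌋ := by exact_mod_cast haQ.1.1
    positivity
  · exact_mod_cast haQ.1.2.1

end Bypass

section Filling

open Set in
/-- Every compact subset of a connected component of an open set in a finite-dimensional space is
contained in a compact connected subset of that component. -/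
theorem exists_isCompact_isPreconnected_superset {M : Type*} [NormedAddCommGroup M]
    [NormedSpace ℝ M] [ProperSpace M] {V K : Set M} (hV : IsOpen V) (hV' : IsPreconnected V)
    {w : M} (hw : w ∈ V) (hK : IsCompact K) (hKV : K ⊆ V) :
    ∃ E, IsCompact E ∧ IsPreconnected E ∧ w ∈ E ∧ K ⊆ E ∧ E ⊆ V := by
  have hpath := hV.isConnected_iff_isPathConnected.1 ⟨⟨w, hw⟩, hV'⟩
  refine hK.induction_on (p := fun s => ∃ E, IsCompact E ∧ IsPreconnected E ∧ w ∈ E ∧ s ⊆ E ∧ E ⊆ V)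
    ⟨{w}, isCompact_singleton, isPreconnected_singleton, rfl, empty_subset _,
      singleton_subset_iff.2 hw⟩ ?_ ?_ ?_
  · rintro s t hst ⟨E, h₁, h₂, h₃, h₄, h₅⟩
    exact ⟨E, h₁, h₂, h₃, hst.trans h₄, h₅⟩
  · rintro s t ⟨E, h₁, h₂, h₃, h₄, h₅⟩ ⟨E', h₁', h₂', h₃', h₄', h₅'⟩
    exact ⟨E ∪ E', h₁.union h₁', h₂.union w h₃ h₃' h₂', .inl h₃, union_subset_union h₄ h₄',
      union_subset h₅ h₅'⟩
  · intro z hz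
    obtain ⟨r, hr, hrV⟩ := Metric.nhds_basis_closedBall.mem_iff.1 (hV.mem_nhds (hKV hz))
    obtain ⟨γ, hγ⟩ := hpath.joinedIn w hw z (hKV hz)
    refine ⟨Metric.closedBall z r, mem_nhdsWithin_of_mem_nhds (Metric.closedBall_mem_nhds z hr),
      range γ ∪ Metric.closedBall z r, (isCompact_range γ.continuous).union
        (isCompact_closedBall z r), ?_, .inl ⟨0, γ.source⟩, subset_union_right,
      union_subset (range_subset_iff.2 hγ) hrV⟩
    exact (isPreconnected_range γ.continuous).union z ⟨1, γ.target⟩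
      (Metric.mem_closedBall_self hr.le) (convex_closedBall z r).isPreconnected

open Set in
/-- The connected component of a point in a compact set can be separated inside that compact set
from a disjoint closed set. -/
theorem exists_isCompact_separating {M : Type*} [TopologicalSpace M] [T2Space M] {A F : Set M}
    (hA : IsCompact A) (hF : IsClosed F) {a : M} (hF' : Disjoint (connectedComponentIn A a) F) :
    ∃ D ⊆ A, IsCompact D ∧ IsCompact (A \ D) ∧ connectedComponentIn A a ⊆ D ∧ Disjoint D F := by
  by_cases ha : a ∈ A
  swap
  · exact ⟨∅, by simp, by simp, by simpa, by simp [connectedComponentIn_eq_empty ha], by simp⟩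
  have := isCompact_iff_compactSpace.1 hA
  have hcomp := connectedComponent_eq_iInter_isClopen (⟨a, ha⟩ : A)
  rw [connectedComponentIn_eq_image ha] at hF' ⊢
  have hFA : IsClosed ((↑) ⁻¹' F : Set A) := hF.preimage continuous_subtype_val
  have : Nonempty {s : Set A // IsClopen s ∧ ⟨a, ha⟩ ∈ s} := ⟨⟨univ, isClopen_univ, trivial⟩⟩
  obtain ⟨⟨s, hs, has⟩, hsF⟩ := hFA.isCompact.elim_directed_family_closed
    (fun s : {s : Set A // IsClopen s ∧ ⟨a, ha⟩ ∈ s} => (s : Set A)) (fun s => s.2.1.1) (by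
      rw [← hcomp, ← disjoint_iff_inter_eq_empty, disjoint_comm]
      exact disjoint_left.2 fun z hz hzF => disjoint_left.1 hF' (mem_image_of_mem _ hz) hzF)
    fun s t => ⟨⟨s ∩ t, s.2.1.inter t.2.1, s.2.2, t.2.2⟩, inter_subset_left, inter_subset_right⟩
  refine ⟨(↑) '' s, Subtype.coe_image_subset _ _, hs.1.isCompact.image continuous_subtype_val, ?_,
    image_mono ?_, ?_⟩
  · have : A \ (↑) '' s = (↑) '' sᶜ := by
      rw [image_compl_eq_range_sdiff_image Subtype.val_injective, Subtype.range_coe]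
    rw [this]
    exact hs.compl.1.isCompact.image continuous_subtype_val
  · rw [hcomp]
    exact iInter_subset (fun s : {s : Set A // IsClopen s ∧ ⟨a, ha⟩ ∈ s} => (s : Set A)) ⟨s, hs, has⟩
  · rw [disjoint_left]
    rintro _ ⟨z, hz, rfl⟩ hzF
    exact (hsF ▸ ⟨hzF, hz⟩ : z ∈ (∅ : Set A))

open Set in
theorem closure_connectedComponentIn_compl_subset {M : Type*} [TopologicalSpace M]
    [LocallyConnectedSpace M] {C : Set M} (hC : IsClosed C) (w : M) :
    closure (connectedComponentIn Cᶜ w) ⊆ connectedComponentIn Cᶜ w ∪ C := by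
  intro z hz
  by_cases hzC : z ∈ C
  · exact .inr hzC
  · obtain ⟨y, hy, hyw⟩ := mem_closure_iff.1 hz _ hC.isOpen_compl.connectedComponentIn
      (mem_connectedComponentIn hzC)
    rw [connectedComponentIn_eq hyw, ← connectedComponentIn_eq hy]
    exact .inl (mem_connectedComponentIn hzC)

open Set in
theorem isPreconnected_square_frame (t₀ : ℝ) :
    IsPreconnected ((((univ ×ˢ Ici 1 ∪ Iic 0 ×ˢ univ) ∪ Ici 1 ×ˢ univ) ∪ Iio t₀ ×ˢ Iic 0) ∪
      Ioi t₀ ×ˢ Iic 0 : Set (ℝ × ℝ)) := by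
  refine .union (max 1 (t₀ + 1), 0) (by simp) (by simp) (.union (min 0 (t₀ - 1), 0) (by simp)
    (by simp) (.union (1, 1) (by simp) (by simp) (.union (0, 1) (by simp) (by simp) ?_ ?_) ?_) ?_) ?_
  all_goals apply Convex.isPreconnected; apply Convex.prod
  exacts [convex_univ, convex_Ici _, convex_Iic _, convex_univ, convex_Ici _, convex_univ,
    convex_Iio _, convex_Iic _, convex_Ioi _, convex_Iic _]

open Set Classical in
/-- Given a map `g` on the plane whose value on the boundary of the unit square is never `p₀` and
equals `p` only in `(t₀, 0)`, one can modify `g` inside the square such that the preimage of `p` is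
covered by two compact sets `D` and `R`, the preimage of `p₀` is covered by a connected set `E`
reaching out of the square, and `D` contains `(t₀, 0)` and is disjoint from `R` and `E`. -/
theorem exists_filling {X : Type*} [TopologicalSpace X] [T1Space X] {p₀ p : X} (hp : p₀ ≠ p)
    {g : ℝ × ℝ → X} (hg : Continuous g) {t₀ : ℝ} (h₀ : 0 < t₀) (h₁ : t₀ < 1) (ha : g (t₀, 0) = p)
    (hbd : ∀ z ∈ Icc (0 : ℝ × ℝ) 1, z.1 = 0 ∨ z.1 = 1 ∨ z.2 = 0 ∨ z.2 = 1 →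
      g z ≠ p₀ ∧ (g z = p → z = (t₀, 0))) :
    ∃ G : ℝ × ℝ → X, Continuous G ∧
      (∀ z ∈ Icc (0 : ℝ × ℝ) 1, z.1 = 0 ∨ z.1 = 1 ∨ z.2 = 0 ∨ z.2 = 1 → G z = g z) ∧
      ∃ E D R : Set (ℝ × ℝ), IsPreconnected E ∧ (0, 2) ∈ E ∧
        (∀ z ∈ Icc (0 : ℝ × ℝ) 1, G z = p₀ → z ∈ E) ∧
        (∀ z ∈ Icc (0 : ℝ × ℝ) 1, G z = p → z ∈ D ∪ R) ∧ (t₀, 0) ∈ D ∧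
        (∀ z ∈ D ∪ R, z.1 = 0 ∨ z.1 = 1 ∨ z.2 = 0 ∨ z.2 = 1 → z = (t₀, 0)) ∧
        ∃ δ > 0, ∀ z ∈ D, ∀ z' ∈ E ∪ R, δ < dist z z' := by
  set I : Set (ℝ × ℝ) := Icc 0 1
  have hI : IsCompact I := isCompact_Icc
  have hclosed : ∀ (G : ℝ × ℝ → X) (q : X), Continuous G → IsCompact (I ∩ G ⁻¹' {q}) :=
    fun G q hG => hI.inter_right (isClosed_singleton.preimage hG)
  have haI : (t₀, 0) ∈ I := ⟨⟨h₀.le, le_rfl⟩, h₁.le, zero_le_one⟩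
  set A := I ∩ g ⁻¹' {p}
  have hA : IsCompact A := hclosed g p hg
  have haA : (t₀, 0) ∈ A := ⟨haI, ha⟩
  set C := connectedComponentIn A (t₀, 0)
  have hCA : C ⊆ A := connectedComponentIn_subset _ _
  have hC : IsClosed C := by
    simp only [C, connectedComponentIn_eq_image haA]
    exact hA.isClosed.isClosedEmbedding_subtypeVal.isClosedMap _ isClosed_connectedComponent
  set V := connectedComponentIn Cᶜ (0, 2)
  have hV : IsOpen V := hC.isOpen_compl.connectedComponentIn
  have hVC : closure V ⊆ V ∪ C := closure_connectedComponentIn_compl_subset hC _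
  have hframe : (((univ ×ˢ Ici 1 ∪ Iic 0 ×ˢ univ) ∪ Ici 1 ×ˢ univ) ∪ Iio t₀ ×ˢ Iic 0) ∪
      Ioi t₀ ×ˢ Iic 0 ⊆ V := by
    refine (isPreconnected_square_frame t₀).subset_connectedComponentIn (by simp) ?_
    intro z hz hzC
    obtain ⟨hzI, hzp⟩ := hCA hzC
    obtain ⟨⟨b₁, b₃⟩, b₂, b₄⟩ := id hzI
    simp only [mem_union, mem_prod, mem_univ, mem_Ici, mem_Iic, mem_Iio, mem_Ioi, true_and,
      and_true] at hz
    simp only [Prod.fst_zero, Prod.snd_zero, Prod.fst_one, Prod.snd_one] at b₁ b₂ b₃ b₄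
    have hzb : z.1 = 0 ∨ z.1 = 1 ∨ z.2 = 0 ∨ z.2 = 1 := by
      rcases hz with (((hz | hz) | hz) | ⟨-, hz⟩) | ⟨-, hz⟩
      · exact .inr (.inr (.inr (b₄.antisymm hz)))
      · exact .inl (hz.antisymm b₁)
      · exact .inr (.inl (b₂.antisymm hz))
      · exact .inr (.inr (.inl (hz.antisymm b₃)))
      · exact .inr (.inr (.inl (hz.antisymm b₃)))
    have := (hbd z hzI hzb).2 hzp
    subst this
    rcases hz with (((hz | hz) | hz) | ⟨hz, -⟩) | ⟨hz, -⟩ <;> simp only at hz <;> linarith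
  have hbdV : ∀ z ∈ I, z.1 = 0 ∨ z.1 = 1 ∨ z.2 = 0 ∨ z.2 = 1 → z ∉ V → z = (t₀, 0) := by
    intro z hzI hzb hzV
    by_contra hne
    refine hzV (hframe ?_)
    simp only [mem_union, mem_prod, mem_univ, mem_Ici, mem_Iic, mem_Iio, mem_Ioi, true_and,
      and_true]
    rcases hzb with h | h | h | h
    · exact .inl (.inl (.inl (.inr h.le)))
    · exact .inl (.inl (.inr h.ge))
    · rcases lt_trichotomy z.1 t₀ with h' | h' | h'
      · exact .inl (.inr ⟨h', h.le⟩)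
      · exact absurd (Prod.ext h' h) hne
      · exact .inr ⟨h', h.le⟩
    · exact .inl (.inl (.inl (.inl h.ge)))
  set G : ℝ × ℝ → X := V.piecewise g fun _ => p
  have hGV : ∀ z ∈ V, G z = g z := fun z hz => piecewise_eq_of_mem _ _ _ hz
  have hGV' : ∀ z ∉ V, G z = p := fun z hz => piecewise_eq_of_notMem _ _ _ hz
  have hG : Continuous G := by
    refine Continuous.piecewise (fun z hz => ?_) hg continuous_const
    rw [hV.frontier_eq] at hz
    exact (hCA ((hVC hz.1).resolve_left hz.2)).2
  have hGg : ∀ z ∈ I, z.1 = 0 ∨ z.1 = 1 ∨ z.2 = 0 ∨ z.2 = 1 → G z = g z := by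
    intro z hzI hzb
    by_cases hzV : z ∈ V
    · exact hGV z hzV
    · rw [hGV' z hzV, hbdV z hzI hzb hzV, ha]
  obtain ⟨E, hE, hE', hwE, hKE, hEV⟩ := exists_isCompact_isPreconnected_superset hV
    isPreconnected_connectedComponentIn (hframe (a := (0, 2)) (by simp)) (hclosed G p₀ hG) fun z hz => by
      by_contra hzV
      exact hp (hz.2.symm.trans (hGV' z hzV))
  obtain ⟨D₀, hD₀A, hD₀, hAD₀, hCD₀, hD₀E⟩ := exists_isCompact_separating hA hE.isClosed
    (a := (t₀, 0)) (disjoint_left.2 fun z hzC hzE =>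
      connectedComponentIn_subset Cᶜ (0, 2) (hEV hzE) hzC)
  have hR : IsCompact ((A \ D₀) ∩ V) := by
    have : (A \ D₀) ∩ V = (A \ D₀) ∩ closure V := by
      refine (inter_subset_inter_right _ subset_closure).antisymm fun z hz => ⟨hz.1, ?_⟩
      exact (hVC hz.2).resolve_right fun h => hz.1.2 (hCD₀ h)
    rw [this]
    exact hAD₀.inter_right isClosed_closure
  have hD : IsCompact (I \ V ∪ D₀) := (hI.diff hV).union hD₀
  have hdisj : Disjoint (I \ V ∪ D₀) (E ∪ (A \ D₀) ∩ V) := by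
    rw [disjoint_left]
    rintro z (hz | hz) (hz' | hz')
    · exact hz.2 (hEV hz')
    · exact hz.2 hz'.2
    · exact disjoint_left.1 hD₀E hz hz'
    · exact hz'.1.2 hz
  obtain ⟨δ, hδ, hδ'⟩ := Metric.exists_pos_forall_lt_edist hD (hE.union hR).isClosed hdisj
  refine ⟨G, hG, hGg, E, I \ V ∪ D₀, (A \ D₀) ∩ V, hE', hwE, fun z hzI hz => hKE ⟨hzI, hz⟩, ?_,
    .inr (hCD₀ (mem_connectedComponentIn haA)), ?_, δ, hδ, fun z hz z' hz' => ?_⟩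
  · intro z hzI hz
    by_cases hzV : z ∈ V
    · by_cases hzD : z ∈ D₀
      · exact .inl (.inr hzD)
      · exact .inr ⟨⟨⟨hzI, (hGV z hzV).symm.trans hz⟩, hzD⟩, hzV⟩
    · exact .inl (.inl ⟨hzI, hzV⟩)
  · have hAb : ∀ z ∈ A, z.1 = 0 ∨ z.1 = 1 ∨ z.2 = 0 ∨ z.2 = 1 → z = (t₀, 0) :=
      fun z hz hzb => (hbd z hz.1 hzb).2 hz.2
    rintro z ((hz | hz) | hz) hzb
    · exact hbdV z hz.1 hzb hz.2
    · exact hAb z (hD₀A hz) hzb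
    · exact hAb z hz.1.1 hzb
  · have := hδ' z hz z' hz'
    rw [edist_dist, ENNReal.lt_ofReal_iff_toReal_lt ENNReal.coe_ne_top] at this
    exact this

end Filling

section LoopBypass

/-- Replacing the middle part of a path in a convex set `s` by a homotopic path. -/
theorem exists_path_replace {E : Type*} [AddCommGroup E] [Module ℝ E] [TopologicalSpace E]
    [IsTopologicalAddGroup E] [ContinuousSMul ℝ E] {O s P : Set E} (hs : Convex ℝ s) (hsO : s ⊆ O)
    {x y z w : O} (hx : (x : E) ∈ s) (hy : (y : E) ∈ s) (hz : (z : E) ∈ s) (hw : (w : E) ∈ s)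
    (hxy : segment ℝ (x : E) y ⊆ P) (hzw : segment ℝ (z : E) w ⊆ P) {γ : Path y z}
    (hγ : ∀ t, (γ t : E) ∈ P)
    (hγ' : ∀ δ : Path y z, (∀ t, (δ t : E) ∈ segment ℝ (y : E) z) → γ.Homotopic δ)
    {β : Path x w} (hβ : ∀ t, (β t : E) ∈ s) :
    ∃ β' : Path x w, (∀ t, (β' t : E) ∈ P) ∧ β.Homotopic β' := by
  obtain ⟨α₁, h₁⟩ := exists_path_mem_segment ((hs.segment_subset hx hy).trans hsO)
  obtain ⟨δ, hδ⟩ := exists_path_mem_segment ((hs.segment_subset hy hz).trans hsO)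
  obtain ⟨α₂, h₂⟩ := exists_path_mem_segment ((hs.segment_subset hz hw).trans hsO)
  refine ⟨(α₁.trans γ).trans α₂, Path.coe_trans_mem (Path.coe_trans_mem (fun t => hxy (h₁ t)) hγ)
    fun t => hzw (h₂ t), ?_⟩
  have : β.Homotopic ((α₁.trans δ).trans α₂) := Path.homotopic_of_convex hs hsO _ _ hβ
    (Path.coe_trans_mem (Path.coe_trans_mem (fun t => hs.segment_subset hx hy (h₁ t))
      fun t => hs.segment_subset hy hz (hδ t)) fun t => hs.segment_subset hz hw (h₂ t))
  exact this.trans (((Path.Homotopic.refl α₁).hcomp (hγ' δ hδ).symm).hcomp (.refl α₂))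

theorem exists_one_div_lt_and_mul_ne_int {δ t : ℝ} (hδ : 0 < δ) (h₀ : 0 < t) (h₁ : t < 1) :
    ∃ n : ℕ, 0 < n ∧ 1 / (n : ℝ) < δ ∧ ∀ k : ℤ, t * n ≠ k := by
  obtain ⟨m, hm⟩ := exists_nat_one_div_lt hδ
  by_cases h : ∀ k : ℤ, t * (m + 1 : ℕ) ≠ k
  · exact ⟨m + 1, m.succ_pos, by exact_mod_cast hm, h⟩
  · push Not at h
    obtain ⟨k, hk⟩ := h
    refine ⟨m + 2, by omega, lt_of_le_of_lt ?_ hm, fun l hl => ?_⟩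
    · push_cast
      gcongr
      norm_num
    · push_cast at hk hl
      have ht : t = (l - k : ℤ) := by push_cast; linarith
      rw [ht] at h₀ h₁
      norm_cast at h₀ h₁
      omega

open Set in
/-- If the bottom side of the unit square is mapped to the complement of `p₀` and no other boundary
point is mapped to `p₀` or `p`, and the bottom side hits `p` exactly once, then the bottom side can
be deformed in the complement of the preimage of `p₀` to a path avoiding the preimage of `p`. -/
theorem exists_path_homotopic_bottom {X : Type*} [TopologicalSpace X] [T1Space X] {p₀ p : X}
    (hp : p₀ ≠ p) {g : ℝ × ℝ → X} (hg : Continuous g) {t₀ : ℝ} (h₀ : 0 < t₀) (h₁ : t₀ < 1)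
    (ha : g (t₀, 0) = p)
    (hbd : ∀ z ∈ Icc (0 : ℝ × ℝ) 1, z.1 = 0 ∨ z.1 = 1 ∨ z.2 = 0 ∨ z.2 = 1 →
      g z ≠ p₀ ∧ (g z = p → z = (t₀, 0))) :
    ∃ G : ℝ × ℝ → X, Continuous G ∧ (∀ t ∈ Icc (0 : ℝ) 1, G (t, 0) = g (t, 0)) ∧
      ∃ (x y : {z | G z ≠ p₀}) (β β' : Path x y), (∀ t, (β t : ℝ × ℝ) = ((t : ℝ), 0)) ∧
        (∀ t, G (β' t) ≠ p) ∧ β.Homotopic β' := by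
  obtain ⟨G, hG, hGg, E, D, R, hE, hwE, hG₀, hGp, haD, hbd', δ, hδ, hdist⟩ :=
    exists_filling hp hg h₀ h₁ ha hbd
  obtain ⟨n, hn, hnδ, hnt⟩ := exists_one_div_lt_and_mul_ne_int hδ h₀ h₁
  obtain ⟨l, r, hl₀, hl₁, hr₀, hr₁, hl, hr, γ, hγ, hγ'⟩ :=
    exists_path_bypass (O := {z | G z ≠ p₀}) hn h₀ h₁ hnt hE hwE
      (fun z hz hzp => hz.2 (hG₀ z hz.1 hzp)) haD
      (fun z hz z' hz' => hnδ.trans (hdist z hz z' (.inl hz')))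
      (fun z hz z' hz' => hnδ.trans (hdist z hz z' (.inr hz'))) hbd'
  have hside : ∀ t ∈ Icc (0 : ℝ) 1, ((t, 0) : ℝ × ℝ) ∈ Icc (0 : ℝ × ℝ) 1 := fun t ht =>
    ⟨⟨ht.1, le_rfl⟩, ht.2, zero_le_one⟩
  have hsO : Icc ((0, 0) : ℝ × ℝ) (1, 0) ⊆ {z | G z ≠ p₀} := by
    rintro ⟨t, y⟩ ⟨⟨b₁, b₂⟩, b₃, b₄⟩
    obtain rfl : y = 0 := b₄.antisymm b₂
    have := hside t ⟨b₁, b₃⟩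
    rw [mem_ofPred_eq, hGg _ this (by simp)]
    exact (hbd _ this (by simp)).1
  have hsP : ∀ c d : ℝ, 0 ≤ c → c ≤ d → d ≤ 1 → (d < t₀ ∨ t₀ < c) →
      segment ℝ ((c, 0) : ℝ × ℝ) (d, 0) ⊆ {z | G z ≠ p} := by
    intro c d hc hcd hd ht z hz
    obtain ⟨⟨b₁, b₂⟩, b₃, b₄⟩ := segment_subset_Icc (show ((c, 0) : ℝ × ℝ) ≤ (d, 0) from
      ⟨hcd, le_rfl⟩) hz
    obtain ⟨t, y⟩ := z
    simp only at b₁ b₂ b₃ b₄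
    obtain rfl : y = 0 := b₄.antisymm b₂
    have hI := hside t ⟨hc.trans b₁, b₃.trans hd⟩
    rw [mem_ofPred_eq, hGg _ hI (by simp)]
    intro h
    have := congrArg Prod.fst ((hbd _ hI (by simp)).2 h)
    simp only at this
    rcases ht with ht | ht <;> linarith
  have hmem : ∀ t ∈ Icc (0 : ℝ) 1, ((t, 0) : ℝ × ℝ) ∈ Icc ((0, 0) : ℝ × ℝ) (1, 0) := fun t ht =>
    ⟨⟨ht.1, le_rfl⟩, ht.2, le_rfl⟩
  let β : Path (⟨(0, 0), hsO (hmem 0 (by simp))⟩ : {z | G z ≠ p₀})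
      ⟨(1, 0), hsO (hmem 1 (by simp))⟩ :=
    { toFun := fun t => ⟨((t : ℝ), 0), hsO (hmem t t.2)⟩
      continuous_toFun := by fun_prop
      source' := by simp
      target' := by simp }
  obtain ⟨β', hβ', hββ'⟩ := exists_path_replace (P := {z | G z ≠ p}) (convex_Icc _ _) hsO
    (hmem 0 (by simp)) (hmem l ⟨hl₀, by linarith⟩) (hmem r ⟨by linarith, hr₁⟩) (hmem 1 (by simp))
    (hsP 0 l le_rfl hl₀ (by linarith) (.inl hl₁)) (hsP r 1 (by linarith) hr₁ le_rfl (.inr hr₀))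
    (fun t h => (hγ t).2 (hGp _ (hγ t).1 h)) hγ' (β := β) fun t => hmem t t.2
  exact ⟨G, hG, fun t ht => hGg _ (hside t ht) (by simp), _, _, β, β', fun t => rfl, hβ', hββ'⟩

end LoopBypass

/-- Let `p₀, p₁, p*` be distinct points of a Hausdorff space `X` and `f` a
loop at `p₁` avoiding `p₀` and hitting `p*` exactly once.  If `f` is
null-homotopic in `X`, then there is a loop `f'` at `p₁` avoiding both `p₀`
and `p*` such that `f` and `f'` are homotopic rel endpoints within
`X \ {p₀}` (i.e. by a homotopy avoiding `p₀`). -/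
theorem stmt_12 (X : Type*) [TopologicalSpace X] [T2Space X]
    (p₀ p₁ pstar : X) (h01 : p₀ ≠ p₁) (h0s : p₀ ≠ pstar) (h1s : p₁ ≠ pstar)
    (f : Path p₁ p₁)
    (hf0 : ∀ t : unitInterval, f t ≠ p₀)
    (hfs : ∃! t : unitInterval, f t = pstar)
    (hnull : f.Homotopic (Path.refl p₁)) :
    ∃ f' : Path p₁ p₁,
      (∀ t : unitInterval, f' t ≠ p₀ ∧ f' t ≠ pstar) ∧
      ∃ H : Path.Homotopy f f', ∀ x : unitInterval × unitInterval, H x ≠ p₀ := by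
  obtain ⟨F⟩ := hnull
  obtain ⟨t₀, ht₀, huniq⟩ := hfs
  set g : ℝ × ℝ → X := fun z =>
    F (Set.projIcc 0 1 zero_le_one z.2, Set.projIcc 0 1 zero_le_one z.1) with hg
  have hgc : Continuous g := by
    have := continuous_projIcc (a := (0 : ℝ)) (b := 1) (h := zero_le_one)
    fun_prop
  have hgf : ∀ t : unitInterval, g (t, 0) = f t := fun t => by simp [hg]
  have h₀ : (0 : ℝ) < t₀ := lt_of_le_of_ne t₀.2.1 fun h => h1s (by
    rw [← ht₀, ← (Subtype.ext h : 0 = t₀), f.source])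
  have h₁ : (t₀ : ℝ) < 1 := lt_of_le_of_ne t₀.2.2 fun h => h1s (by
    rw [← ht₀, (Subtype.ext h : t₀ = 1), f.target])
  have hbd : ∀ z ∈ Set.Icc (0 : ℝ × ℝ) 1, z.1 = 0 ∨ z.1 = 1 ∨ z.2 = 0 ∨ z.2 = 1 →
      g z ≠ p₀ ∧ (g z = pstar → z = ((t₀ : ℝ), 0)) := by
    rintro ⟨x, y⟩ ⟨⟨b₁, b₂⟩, b₃, b₄⟩ hz
    have hside : g (x, y) = p₁ → g (x, y) ≠ p₀ ∧ (g (x, y) = pstar → (x, y) = ((t₀ : ℝ), 0)) :=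
      fun h => h ▸ ⟨h01.symm, fun h => absurd h h1s⟩
    rcases hz with h | h | h | h <;> simp only at h <;> subst h
    · exact hside (by simp [hg])
    · exact hside (by simp [hg])
    · have hx : g (x, 0) = f ⟨x, b₁, b₃⟩ := hgf ⟨x, b₁, b₃⟩
      rw [hx]
      exact ⟨hf0 _, fun h => Prod.ext (congrArg Subtype.val (huniq _ h)) rfl⟩
    · exact hside (by simp [hg])
  obtain ⟨G, hG, hGg, x, y, β, β', hβ, hβ', ⟨H⟩⟩ :=
    exists_path_homotopic_bottom h0s hgc h₀ h₁ ((hgf t₀).trans ht₀) hbd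
  have hGβ : ∀ t, G (β t) = f t := fun t => by rw [hβ, hGg _ t.2, hgf]
  have hx : p₁ = G x := by simpa using (hGβ 0).symm
  have hy : p₁ = G y := by simpa using (hGβ 1).symm
  let Γ : C({z | G z ≠ p₀}, X) := ⟨fun z => G z, hG.comp continuous_subtype_val⟩
  refine ⟨(β'.map Γ.continuous).cast hx hy, fun t => ⟨(β' t).2, hβ' t⟩,
    ((H.map Γ).pathCast hx hy).cast (Path.ext (funext hGβ)) rfl, fun z => (H z).2⟩
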